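/- Let Q₁, …, Q_ℓ ∈ ℝ^N satisfy |Q_i − Q_j| ≥ 1 for all i ≠ j, suppose a_{ij} = 0 whenever i ≠ j and |Q_i − Q_j| > 1, and suppose a_{i₀j₀} ≠ 0 for some i₀ ≠ j₀. If for every i = 1, …, ℓ one has Σ_{j≠i} a_{ij}·(Q_i − Q_j)/|Q_i − Q_j| = 0 (i.e. (Q₁, …, Q_ℓ) is a critical point of the function Φ(Z₁, …, Z_ℓ) = Σ_{i≠j} a_{ij}|Z_i − Z_j|), then ℓ ≥ 7. -/

import Mathlib

open Finset

lemma sign_lemma {ι : Type*} [Fintype ι] [DecidableEq ι] (E : ι → ι → ℝ) (p : ι → ℝ)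
    (hE : ∀ i j, 0 ≤ E i j) (hd : ∀ i, E i i = 0)
    (hp : ∀ k, ∑ j, E k j * p j = p k) (hs : ∑ j, p j = 0) (i₀ : ι) (h0 : p i₀ ≠ 0) :
    2 ≤ (univ.filter fun i => 0 < p i).card := by
  have h1 : ∃ i, 0 < p i := by
    by_contra! h
    have := (Finset.sum_eq_zero_iff_of_nonpos (fun i _ => h i)).1 hs i₀ (mem_univ _)
    exact h0 this
  obtain ⟨i, hi⟩ := h1
  have h2 : ∃ j, 0 < E i j * p j := by
    by_contra! h
    have := Finset.sum_nonpos (fun j (_ : j ∈ univ) => h j)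
    rw [hp] at this
    linarith
  obtain ⟨j, hj⟩ := h2
  have hpj : 0 < p j := pos_of_mul_pos_right hj (hE i j)
  have hij : i ≠ j := by
    rintro rfl
    simp [hd] at hj
  have : ({i, j} : Finset ι) ⊆ univ.filter fun i => 0 < p i := by
    intro k hk
    simp at hk
    rcases hk with rfl | rfl <;> simp [*]
  calc 2 = ({i, j} : Finset ι).card := (Finset.card_pair hij).symm
    _ ≤ _ := Finset.card_le_card this

lemma sign_lemma4 {ι : Type*} [Fintype ι] [DecidableEq ι] (E : ι → ι → ℝ) (p : ι → ℝ)
    (hE : ∀ i j, 0 ≤ E i j) (hd : ∀ i, E i i = 0)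
    (hp : ∀ k, ∑ j, E k j * p j = p k) (hs : ∑ j, p j = 0) (i₀ : ι) (h0 : p i₀ ≠ 0) :
    4 ≤ (univ.filter fun i => p i ≠ 0).card := by
  have h1 := sign_lemma E p hE hd hp hs i₀ h0
  have h2 := sign_lemma E (fun i => - p i) hE hd (by intro k; simp [hp]) (by simp [hs]) i₀
    (by simpa using h0)
  have hdis : Disjoint (univ.filter fun i => 0 < p i) (univ.filter fun i => 0 < - p i) := by
    rw [Finset.disjoint_filter]
    intro i _ h h'
    linarith
  have hsub : (univ.filter fun i => 0 < p i) ∪ (univ.filter fun i => 0 < - p i) ⊆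
      univ.filter fun i => p i ≠ 0 := by
    intro i hi
    simp only [mem_union, mem_filter, mem_univ, true_and] at hi ⊢
    rcases hi with h | h <;> intro h' <;> linarith
  have := Finset.card_le_card hsub
  rw [Finset.card_union_of_disjoint hdis] at this
  omega

lemma rank_two_core {ι : Type*} [Fintype ι] [DecidableEq ι] [Nonempty ι]
    (E : ι → ι → ℝ) (p q : ι → ℝ) (cp cq : ℝ)
    (hE : ∀ i j, 0 ≤ E i j) (hd : ∀ i, E i i = 0)
    (hO : ∀ i j, E i j ≠ 0 → p i * q j + p j * q i = 0)
    (hp : ∀ k, ∑ j, E k j * p j = p k + cp) (hq : ∀ k, ∑ j, E k j * q j = q k + cq)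
    (hsp : ∑ j, p j = 0) (hsq : ∑ j, q j = 0)
    (hne : ∀ i, p i ≠ 0 ∨ q i ≠ 0) (hexp : ∃ k, p k ≠ 0) (hexq : ∃ k, q k ≠ 0) : 8 ≤ Fintype.card ι := by
  have hp0 : ∀ k, p k = 0 → cp = 0 := by
    intro k hk
    have h := hp k
    rw [hk, zero_add] at h
    rw [← h]
    refine Finset.sum_eq_zero fun j _ => ?_
    by_cases he : E k j = 0
    · simp [he]
    · have := hO k j he
      rw [hk] at this
      have hqk : q k ≠ 0 := (hne k).resolve_left (by simp [hk])
      have : p j = 0 := by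
        have : p j * q k = 0 := by linarith
        exact (mul_eq_zero.1 this).resolve_right hqk
      simp [this]
  have hq0 : ∀ k, q k = 0 → cq = 0 := by
    intro k hk
    have h := hq k
    rw [hk, zero_add] at h
    rw [← h]
    refine Finset.sum_eq_zero fun j _ => ?_
    by_cases he : E k j = 0
    · simp [he]
    · have := hO k j he
      rw [hk] at this
      have hqk : p k ≠ 0 := (hne k).resolve_right (by simp [hk])
      have : q j = 0 := by
        have : p k * q j = 0 := by linarith
        exact (mul_eq_zero.1 this).resolve_left hqk
      simp [this]
  -- diagonal relation
  have hdiag : ∀ i, 2 * (p i * q i) + p i * cq + q i * cp = 0 := by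
    intro i
    have h : ∑ j, E i j * (p i * q j + p j * q i) = 0 := by
      refine Finset.sum_eq_zero fun j _ => ?_
      by_cases he : E i j = 0
      · simp [he]
      · simp [hO i j he]
    have h2 : ∑ j, E i j * (p i * q j + p j * q i)
        = p i * ∑ j, E i j * q j + q i * ∑ j, E i j * p j := by
      rw [Finset.mul_sum, Finset.mul_sum, ← Finset.sum_add_distrib]
      exact Finset.sum_congr rfl fun j _ => by ring
    rw [h2, hp, hq] at h
    linarith
  -- for a non-isotropic vertex, its column vanishes
  have hcol : ∀ k, p k ≠ 0 → q k ≠ 0 → ∀ j, E k j = 0 := by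
    intro k hpk hqk j
    by_contra hkj
    have par : ∀ m, E k m ≠ 0 → p m = (p m / p k) * p k ∧ q m = - (p m / p k) * q k := by
      intro m hm
      have := hO k m hm
      constructor
      · field_simp
      · field_simp; linarith
    obtain ⟨T, hT1, hT2⟩ : ∃ T, p k + cp = T * p k ∧ q k + cq = - T * q k := by
      refine ⟨∑ m, E k m * (p m / p k), ?_, ?_⟩
      · rw [← hp, Finset.sum_mul]
        refine Finset.sum_congr rfl fun m _ => ?_
        field_simp
      · rw [← hq, neg_mul, Finset.sum_mul, ← Finset.sum_neg_distrib]
        refine Finset.sum_congr rfl fun m _ => ?_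
        by_cases he : E k m = 0
        · simp [he]
        · rw [(par m he).2]; ring
    set t := p j / p k with ht
    obtain ⟨hpj, hqj⟩ := par j hkj
    have ht0 : t ≠ 0 := by
      intro h
      rw [← ht, h] at hpj hqj
      rcases hne j with h' | h' <;> simp_all
    rw [← ht] at hpj hqj
    -- neighbours of j equal g_k
    have nb : ∀ i, E j i ≠ 0 → p i = p k ∧ q i = q k := by
      intro i hi
      have h := hO j i hi
      rw [hpj, hqj] at h
      have h1 : p k * q i = p i * q k := by
        have : t * (p k * q i - p i * q k) = 0 := by linarith
        have := (mul_eq_zero.1 this).resolve_left ht0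
        linarith
      have hpi : p i ≠ 0 := by
        intro h0
        rw [h0] at h1
        have : q i = 0 := by
          rw [zero_mul] at h1
          exact (mul_eq_zero.1 h1).resolve_left hpk
        rcases hne i with h' | h' <;> contradiction
      have h2 := hdiag i
      have h3 := hdiag k
      obtain ⟨u, hu⟩ : ∃ u, p i = u * p k := ⟨p i / p k, by field_simp⟩
      have hqi : q i = u * q k := by
        rw [hu] at h1
        exact mul_left_cancel₀ hpk (by linarith)
      rw [hu, hqi] at h2
      have hu0 : u ≠ 0 := by
        rintro rfl
        simp [hu] at hpi
      have : u * (u - 1) * (2 * (p k * q k)) = 0 := by linear_combination h2 - u * h3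
      have hu1 : u = 1 := by
        have h5 : u * (2 * (p k * q k)) ≠ 0 := by positivity
        have : (u - 1) * (u * (2 * (p k * q k))) = 0 := by linarith
        have := (mul_eq_zero.1 this).resolve_right h5
        linarith
      rw [hu, hqi, hu1]
      simp
    have hS1 : p j + cp = (∑ i, E j i) * p k := by
      rw [← hp, Finset.sum_mul]
      refine Finset.sum_congr rfl fun m _ => ?_
      by_cases he : E j m = 0
      · simp [he]
      · rw [(nb m he).1]
    have hS2 : q j + cq = (∑ i, E j i) * q k := by
      rw [← hq, Finset.sum_mul]
      refine Finset.sum_congr rfl fun m _ => ?_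
      by_cases he : E j m = 0
      · simp [he]
      · rw [(nb m he).2]
    have hS : 0 ≤ ∑ i, E j i := Finset.sum_nonneg fun i _ => hE j i
    set S := ∑ i, E j i
    have e1 : T - 1 = S - t := mul_right_cancel₀ hpk (by linarith)
    have e2 : -T - 1 = S + t := mul_right_cancel₀ hqk (by linarith)
    linarith
  have hiso : ∀ k, p k = 0 ∨ q k = 0 := by
    intro k
    by_contra! hk
    obtain ⟨hpk, hqk⟩ := hk
    have key : ∀ m, p m ≠ 0 → q m ≠ 0 → p m = -cp ∧ q m = -cq := by
      intro m h1 h2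
      have h3 := hcol m h1 h2
      have h4 := hp m
      have h5 := hq m
      simp only [h3, zero_mul, Finset.sum_const_zero] at h4 h5
      constructor <;> linarith
    have hk' := key k hpk hqk
    have hall : ∀ m, p m = -cp := by
      intro m
      refine (key m ?_ ?_).1
      · intro h
        have := hp0 m h
        apply hpk
        rw [hk'.1, this, neg_zero]
      · intro h
        have := hq0 m h
        apply hqk
        rw [hk'.2, this, neg_zero]
    simp only [hall, Finset.sum_const, nsmul_eq_mul, mul_eq_zero, Nat.cast_eq_zero] at hsp
    rcases hsp with h | h
    · simp at h
    · exact hpk (hk'.1.trans h)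
  obtain ⟨i, hi⟩ := hexp
  obtain ⟨j, hj⟩ := hexq
  have hcq : cq = 0 := hq0 i ((hiso i).resolve_left hi)
  have hcp : cp = 0 := hp0 j ((hiso j).resolve_right hj)
  subst hcq hcp
  have h1 := sign_lemma4 E p hE hd (by simpa using hp) hsp i hi
  have h2 := sign_lemma4 E q hE hd (by simpa using hq) hsq j hj
  have hdis : Disjoint (univ.filter fun i => p i ≠ 0) (univ.filter fun i => q i ≠ 0) := by
    rw [Finset.disjoint_filter]
    intro i _ h h'
    rcases hiso i with h'' | h'' <;> contradiction
  have := Finset.card_le_univ ((univ.filter fun i => p i ≠ 0) ∪ (univ.filter fun i => q i ≠ 0))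
  rw [Finset.card_union_of_disjoint hdis] at this
  omega

section
variable {V : Type*} [NormedAddCommGroup V] [InnerProductSpace ℝ V]

lemma two_indep (x y e : V) (hx : ‖x‖ = 1) (hy : ‖y‖ = 1) (hxy : inner ℝ x y ≤ (1/2:ℝ))
    (hxe : 0 < inner ℝ x e) (hye : 0 < inner ℝ y e) (α β : ℝ) (h : α • x + β • y = 0) :
    α = 0 ∧ β = 0 := by
  have h1 : inner ℝ x (α • x + β • y) = 0 := by rw [h, inner_zero_right]
  have h2 : inner ℝ y (α • x + β • y) = 0 := by rw [h, inner_zero_right]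
  have h3 : inner ℝ (α • x + β • y) e = 0 := by rw [h, inner_zero_left]
  simp only [inner_add_right, inner_add_left, inner_smul_right, real_inner_smul_left,
    real_inner_self_eq_norm_sq, hx, hy, real_inner_comm x y] at h1 h2 h3
  set c : ℝ := inner ℝ x y
  have hα : α * (1 - c ^ 2) = 0 := by linear_combination h1 - c * h2
  have hβ : β * (1 - c ^ 2) = 0 := by linear_combination h2 - c * h1
  by_cases hc : 1 - c ^ 2 = 0
  · have : c = -1 := by
      have : (1 - c) * (1 + c) = 0 := by linarith
      rcases mul_eq_zero.1 this with h | h <;> linarith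
    rw [this] at h1
    have hab : α = β := by linarith
    subst hab
    have : α * (inner ℝ x e + inner ℝ y e) = 0 := by linarith
    have := (mul_eq_zero.1 this).resolve_right (by linarith)
    exact ⟨this, this⟩
  · exact ⟨(mul_eq_zero.1 hα).resolve_right hc, (mul_eq_zero.1 hβ).resolve_right hc⟩

lemma mid (x y z : V) (hx : ‖x‖ = 1) (hy : ‖y‖ = 1) (hz : ‖z‖ = 1)
    (hxy : inner ℝ x y ≤ (1/2:ℝ)) (hyz : inner ℝ y z ≤ (1/2:ℝ))
    (α β γ : ℝ) (hα : 0 < α) (hβ : β < 0) (hγ : 0 < γ) (h : α • x + β • y + γ • z = 0) :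
    inner ℝ x z ≤ (-1/2:ℝ) ∧ (inner ℝ x z = (-1/2:ℝ) → y = x + z) := by
  have h1 : inner ℝ x (α • x + β • y + γ • z) = 0 := by rw [h, inner_zero_right]
  have h2 : inner ℝ y (α • x + β • y + γ • z) = 0 := by rw [h, inner_zero_right]
  have h3 : inner ℝ z (α • x + β • y + γ • z) = 0 := by rw [h, inner_zero_right]
  simp only [inner_add_right, inner_smul_right,
    real_inner_self_eq_norm_sq, hx, hy, hz, real_inner_comm x y, real_inner_comm y z,
    real_inner_comm x z] at h1 h2 h3
  set c : ℝ := inner ℝ x z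
  set d : ℝ := inner ℝ x y
  set f : ℝ := inner ℝ y z
  have g1 : -2 * β ≤ α + γ := by nlinarith
  have g2 : (α + γ) * (1 + c) ≤ - β := by nlinarith
  have hc : c ≤ -1/2 := by
    by_contra! hc
    nlinarith
  refine ⟨hc, fun hc => ?_⟩
  have g3 : α + γ = -2 * β := by rw [hc] at g2; linarith
  have g4 : α * (1/2 - d) + γ * (1/2 - f) = 0 := by linarith
  have a1 : 0 ≤ α * (1/2 - d) := mul_nonneg hα.le (by linarith)
  have a2 : 0 ≤ γ * (1/2 - f) := mul_nonneg hγ.le (by linarith)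
  have d1 : d = 1/2 := by
    have : α * (1/2 - d) = 0 := by linarith
    have := (mul_eq_zero.1 this).resolve_left hα.ne'
    linarith
  rw [hc, d1] at h1
  have e1 : α = -β := by linarith
  have e2 : γ = -β := by linarith
  have : β • (y - (x + z)) = 0 := by
    rw [← h, e1, e2]; module
  exact sub_eq_zero.1 ((smul_eq_zero.1 this).resolve_left hβ.ne)

lemma three_planar (x y z e : V) (hx : ‖x‖ = 1) (hy : ‖y‖ = 1) (hz : ‖z‖ = 1)
    (hxy : inner ℝ x y ≤ (1/2:ℝ)) (hyz : inner ℝ y z ≤ (1/2:ℝ)) (hxz : inner ℝ x z ≤ (1/2:ℝ))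
    (hxe : 0 < inner ℝ x e) (hye : 0 < inner ℝ y e) (hze : 0 < inner ℝ z e)
    (hdep : ∃ α β γ : ℝ, ¬ (α = 0 ∧ β = 0 ∧ γ = 0) ∧ α • x + β • y + γ • z = 0) :
    (inner ℝ x z ≤ (-1/2:ℝ) ∧ (inner ℝ x z = (-1/2:ℝ) → y = x + z)) ∨
    (inner ℝ x y ≤ (-1/2:ℝ) ∧ (inner ℝ x y = (-1/2:ℝ) → z = x + y)) ∨
    (inner ℝ y z ≤ (-1/2:ℝ) ∧ (inner ℝ y z = (-1/2:ℝ) → x = y + z)) := by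
  obtain ⟨α, β, γ, hn, h⟩ := hdep
  have hα : α ≠ 0 := by
    rintro rfl
    have := two_indep y z e hy hz hyz hye hze β γ (by simpa using h)
    exact hn ⟨rfl, this⟩
  have hβ : β ≠ 0 := by
    rintro rfl
    have := two_indep x z e hx hz hxz hxe hze α γ (by simpa using h)
    exact hn ⟨this.1, rfl, this.2⟩
  have hγ : γ ≠ 0 := by
    rintro rfl
    have := two_indep x y e hx hy hxy hxe hye α β (by simpa using h)
    exact hn ⟨this.1, this.2, rfl⟩
  have h3 : inner ℝ (α • x + β • y + γ • z) e = 0 := by rw [h, inner_zero_left]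
  simp only [inner_add_left, real_inner_smul_left] at h3
  have hneg : (-α) • x + (-β) • y + (-γ) • z = 0 := by
    rw [← neg_eq_zero, ← h]; module
  have hyx : inner ℝ y x ≤ (1/2:ℝ) := by rw [real_inner_comm]; exact hxy
  have hzy : inner ℝ z y ≤ (1/2:ℝ) := by rw [real_inner_comm]; exact hyz
  rcases lt_or_gt_of_ne hα with sa | sa <;> rcases lt_or_gt_of_ne hβ with sb | sb <;>
    rcases lt_or_gt_of_ne hγ with sc | sc
  · nlinarith
  · right; left
    exact mid x z y hx hz hy hxz hzy (-α) (-γ) (-β) (by linarith) (by linarith) (by linarith)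
      (by rw [← hneg]; module)
  · left
    exact mid x y z hx hy hz hxy hyz (-α) (-β) (-γ) (by linarith) (by linarith) (by linarith) hneg
  · right; right
    exact mid y x z hy hx hz hyx hxz β α γ sb sa sc (by rw [← h]; module)
  · right; right
    exact mid y x z hy hx hz hyx hxz (-β) (-α) (-γ) (by linarith) (by linarith) (by linarith)
      (by rw [← hneg]; module)
  · left
    exact mid x y z hx hy hz hxy hyz α β γ sa sb sc h
  · right; left
    exact mid x z y hx hz hy hxz hzy α γ β sa sc sb (by rw [← h]; module)
  · nlinarith [mul_pos sa hxe, mul_pos sb hye, mul_pos sc hze]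

end

section
variable {V : Type*} [NormedAddCommGroup V] [InnerProductSpace ℝ V]

lemma inner_le_half (x y : V) (hx : ‖x‖ = 1) (hy : ‖y‖ = 1) (h : 1 ≤ ‖x - y‖) :
    inner ℝ x y ≤ (1/2:ℝ) := by
  have h1 := norm_sub_sq_real x y
  rw [hx, hy] at h1
  nlinarith

variable {ι : Type*} [Fintype ι] [DecidableEq ι]

lemma deg_three (W : ι → ι → ℝ) (Q : ι → V)
    (hrow : ∀ i, ∑ j, W i j = 0) (hQ : ∀ i, ∑ j, W i j • Q j = 0)
    (hedge : ∀ i j, i ≠ j → W i j ≠ 0 → ‖Q j - Q i‖ = 1)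
    (hsep : ∀ i j, i ≠ j → 1 ≤ ‖Q i - Q j‖) (hnz : ∀ i, ∃ j, W i j ≠ 0)
    (u : ι) (e : V) (he : ∀ j, j ≠ u → W u j ≠ 0 → 0 < inner ℝ (Q j - Q u) e) :
    3 ≤ (univ.filter fun j => j ≠ u ∧ W u j ≠ 0).card := by
  set M := univ.filter fun j => j ≠ u ∧ W u j ≠ 0 with hM
  have hmem : ∀ j, j ∈ M ↔ j ≠ u ∧ W u j ≠ 0 := by intro j; simp [hM]
  have hsum : ∑ j ∈ M, W u j • (Q j - Q u) = 0 := by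
    have h1 : ∑ j ∈ M, W u j • (Q j - Q u) = ∑ j, W u j • (Q j - Q u) := by
      refine Finset.sum_subset (Finset.subset_univ _) fun j _ hj => ?_
      rw [hmem] at hj
      by_cases h : j = u
      · simp [h]
      · have : W u j = 0 := by by_contra h'; exact hj ⟨h, h'⟩
        simp [this]
    rw [h1]
    simp only [smul_sub, Finset.sum_sub_distrib, hQ, ← Finset.sum_smul, hrow, zero_smul, sub_zero]
  have hin : ∀ j ∈ M, ∀ k ∈ M, j ≠ k → inner ℝ (Q j - Q u) (Q k - Q u) ≤ (1/2:ℝ) := by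
    intro j hj k hk hjk
    rw [hmem] at hj hk
    apply inner_le_half _ _ (hedge u j hj.1.symm hj.2) (hedge u k hk.1.symm hk.2)
    rw [sub_sub_sub_cancel_right]
    exact hsep j k hjk
  by_contra! hc
  have hcases : M.card = 0 ∨ M.card = 1 ∨ M.card = 2 := by omega
  rcases hcases with h | h | h
  · rw [Finset.card_eq_zero] at h
    have hz : ∀ j, j ≠ u → W u j = 0 := by
      intro j hj
      by_contra h'
      have : j ∈ M := (hmem j).2 ⟨hj, h'⟩
      simp [h] at this
    have h2 := hrow u
    rw [Finset.sum_eq_single u (fun j _ hj => hz j hj) (by simp)] at h2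
    obtain ⟨j, hj⟩ := hnz u
    by_cases h3 : j = u
    · exact hj (h3 ▸ h2)
    · exact hj (hz j h3)
  · obtain ⟨j, hj⟩ := Finset.card_eq_one.1 h
    have hjM : j ∈ M := by simp [hj]
    rw [hmem] at hjM
    rw [hj, Finset.sum_singleton] at hsum
    have := (smul_eq_zero.1 hsum).resolve_left hjM.2
    have h2 := hedge u j hjM.1.symm hjM.2
    rw [this] at h2
    simp at h2
  · obtain ⟨j, k, hjk, hj⟩ := Finset.card_eq_two.1 h
    have hjM : j ∈ M := by simp [hj]
    have hkM : k ∈ M := by simp [hj]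
    have hi := hin j hjM k hkM hjk
    rw [hmem] at hjM hkM
    rw [hj, Finset.sum_pair hjk] at hsum
    have := two_indep _ _ e (hedge u j hjM.1.symm hjM.2) (hedge u k hkM.1.symm hkM.2) hi
      (he j hjM.1 hjM.2) (he k hkM.1 hkM.2) _ _ hsum
    exact hjM.2 this.1

lemma planar_final (r s t e : V) (hr : ‖r‖ = 1) (_hs : ‖s‖ = 1)
    (he : e = s + t) (ht : t = r + s) (hrs : inner ℝ r s = (-1/2:ℝ))
    (hre : 0 < inner ℝ r e) : False := by
  rw [he, ht, inner_add_right, inner_add_right, hrs, real_inner_self_eq_norm_sq, hr] at hre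
  norm_num at hre

lemma planar_false [Nonempty ι] (W : ι → ι → ℝ) (Q : ι → V)
    (hcard : Fintype.card ι ≤ 6)
    (hrow : ∀ i, ∑ j, W i j = 0) (hQ : ∀ i, ∑ j, W i j • Q j = 0)
    (hedge : ∀ i j, i ≠ j → W i j ≠ 0 → ‖Q j - Q i‖ = 1)
    (hsep : ∀ i j, i ≠ j → 1 ≤ ‖Q i - Q j‖) (hnz : ∀ i, ∃ j, W i j ≠ 0)
    (S : Submodule ℝ V) (hQS : ∀ i j, Q i - Q j ∈ S)
    (hS : ∀ x ∈ S, ∀ y ∈ S, ∀ z ∈ S,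
      ∃ α β γ : ℝ, ¬ (α = 0 ∧ β = 0 ∧ γ = 0) ∧ α • x + β • y + γ • z = 0) : False := by
  obtain ⟨⟨u, w⟩, huw⟩ := Finite.exists_max (fun x : ι × ι => ‖Q x.1 - Q x.2‖)
  have hmax : ∀ i j, ‖Q i - Q j‖ ≤ ‖Q u - Q w‖ := fun i j => huw (i, j)
  have ext : ∀ u w : ι, (∀ i j, ‖Q i - Q j‖ ≤ ‖Q u - Q w‖) →
      ∀ j, j ≠ u → W u j ≠ 0 → 0 < inner ℝ (Q j - Q u) (Q w - Q u) := by
    intro u w hm j hj hW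
    have h1 := hedge u j hj.symm hW
    have h2 := norm_sub_sq_real (Q j - Q u) (Q w - Q u)
    rw [sub_sub_sub_cancel_right, h1, norm_sub_rev (Q w)] at h2
    have h3 := hm j w
    have h4 := norm_nonneg (Q j - Q w)
    nlinarith
  have eu := ext u w hmax
  have ew := ext w u (fun i j => by rw [norm_sub_rev (Q w)]; exact hmax i j)
  have du := deg_three W Q hrow hQ hedge hsep hnz u _ eu
  have dw := deg_three W Q hrow hQ hedge hsep hnz w _ ew
  set A := univ.filter fun j => j ≠ u ∧ W u j ≠ 0 with hA
  set B := univ.filter fun j => j ≠ w ∧ W w j ≠ 0 with hB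
  have hmA : ∀ j, j ∈ A ↔ j ≠ u ∧ W u j ≠ 0 := by intro j; simp [hA]
  have hmB : ∀ j, j ∈ B ↔ j ≠ w ∧ W w j ≠ 0 := by intro j; simp [hB]
  have nA : ∀ j ∈ A, ‖Q j - Q u‖ = 1 := fun j hj =>
    hedge u j ((hmA j).1 hj).1.symm ((hmA j).1 hj).2
  have nB : ∀ j ∈ B, ‖Q j - Q w‖ = 1 := fun j hj =>
    hedge w j ((hmB j).1 hj).1.symm ((hmB j).1 hj).2
  have iA : ∀ j ∈ A, 0 < inner ℝ (Q j - Q u) (Q w - Q u) := fun j hj =>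
    eu j ((hmA j).1 hj).1 ((hmA j).1 hj).2
  have hin : ∀ j ∈ A, ∀ k ∈ A, j ≠ k → inner ℝ (Q j - Q u) (Q k - Q u) ≤ (1/2:ℝ) := by
    intro j hj k hk hjk
    apply inner_le_half _ _ (nA j hj) (nA k hk)
    rw [sub_sub_sub_cancel_right]
    exact hsep j k hjk
  have three : ∀ i ∈ A, ∀ j ∈ A, ∀ k ∈ A, i ≠ j → j ≠ k → i ≠ k → _ :=
    fun i hi j hj k hk hij hjk hik =>
    three_planar (Q i - Q u) (Q j - Q u) (Q k - Q u) (Q w - Q u) (nA i hi) (nA j hj) (nA k hk)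
      (hin i hi j hj hij) (hin j hj k hk hjk) (hin i hi k hk hik) (iA i hi) (iA j hj) (iA k hk)
      (hS _ (hQS _ _) _ (hQS _ _) _ (hQS _ _))
  -- distances from inner products
  have dist_ip : ∀ i ∈ A, ∀ j ∈ A,
      ‖Q i - Q j‖ ^ 2 = 2 - 2 * inner ℝ (Q i - Q u) (Q j - Q u) := by
    intro i hi j hj
    have h2 := norm_sub_sq_real (Q i - Q u) (Q j - Q u)
    rw [sub_sub_sub_cancel_right, nA i hi, nA j hj] at h2
    linarith
  have hsq : ∀ i j, ‖Q i - Q j‖ ^ 2 ≤ ‖Q u - Q w‖ ^ 2 := fun i j =>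
    pow_le_pow_left₀ (norm_nonneg _) (hmax i j) 2
  have hδ : 3 ≤ ‖Q u - Q w‖ ^ 2 := by
    obtain ⟨i, j, k, hi, hj, hk, hij, hik, hjk⟩ := Finset.two_lt_card_iff.1 (show 2 < A.card by omega)
    rcases three i hi j hj k hk hij hjk hik with h | h | h
    · linarith [dist_ip i hi k hk, hsq i k, h.1]
    · linarith [dist_ip i hi j hj, hsq i j, h.1]
    · linarith [dist_ip j hj k hk, hsq j k, h.1]
  have huwne : u ≠ w := by
    rintro rfl
    simp at hδ
    linarith
  have hwA : w ∉ A := by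
    intro h
    have := nA w h
    rw [norm_sub_rev] at this
    rw [this] at hδ
    norm_num at hδ
  have huB : u ∉ B := by
    intro h
    have := nB u h
    rw [this] at hδ
    norm_num at hδ
  have huA : u ∉ A := by simp [hmA]
  have hwB : w ∉ B := by simp [hmB]
  have hunion : A ∪ B ⊆ univ \ {u, w} := by
    intro j hj
    simp only [mem_sdiff, mem_univ, true_and, mem_insert, mem_singleton, not_or]
    rcases Finset.mem_union.1 hj with h | h
    · exact ⟨fun h' => huA (h' ▸ h), fun h' => hwA (h' ▸ h)⟩
    · exact ⟨fun h' => huB (h' ▸ h), fun h' => hwB (h' ▸ h)⟩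
  have hcu : (A ∪ B).card ≤ 4 := by
    have := Finset.card_le_card hunion
    rw [Finset.card_sdiff_of_subset (Finset.subset_univ _), Finset.card_pair huwne, Finset.card_univ] at this
    omega
  have hci : 1 < (A ∩ B).card := by
    have := Finset.card_union_add_card_inter A B
    omega
  obtain ⟨s, hs, t, ht, hst⟩ := Finset.one_lt_card.1 hci
  obtain ⟨hsA, hsB⟩ := Finset.mem_inter.1 hs
  obtain ⟨htA, htB⟩ := Finset.mem_inter.1 ht
  -- rhombus
  have ise : ∀ j ∈ A, j ∈ B → 2 * inner ℝ (Q j - Q u) (Q w - Q u) = ‖Q w - Q u‖ ^ 2 := by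
    intro j hjA hjB
    have h2 := norm_sub_sq_real (Q j - Q u) (Q w - Q u)
    rw [sub_sub_sub_cancel_right, nA j hjA, nB j hjB] at h2
    linarith
  have hs1 := ise s hsA hsB
  have ht1 := ise t htA htB
  have heq : ‖Q u - Q w‖ = ‖Q w - Q u‖ := norm_sub_rev _ _
  have hns := nA s hsA
  have hnt := nA t htA
  have hsub : (Q s - Q u) - (Q t - Q u) ≠ 0 := by
    intro h
    have h2 := hsep s t hst
    rw [sub_sub_sub_cancel_right] at h
    rw [h, norm_zero] at h2
    linarith
  have hrh : Q w - Q u = (Q s - Q u) + (Q t - Q u) := by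
    have hxS := hQS s u
    have hyS := hQS t u
    have heS := hQS w u
    rw [heq] at hδ
    generalize Q s - Q u = x at *
    generalize Q t - Q u = y at *
    generalize Q w - Q u = e at *
    obtain ⟨α, β, γ, hn, h⟩ := hS e heS (x - y) (S.sub_mem hxS hyS) (x + y - e)
      (S.sub_mem (S.add_mem hxS hyS) heS)
    have o1 : inner ℝ e (x - y) = 0 := by
      rw [inner_sub_right, real_inner_comm x, real_inner_comm y]; linarith
    have o2 : inner ℝ e (x + y - e) = 0 := by
      rw [inner_sub_right, inner_add_right, real_inner_comm x, real_inner_comm y,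
        real_inner_self_eq_norm_sq]; linarith
    have o3 : inner ℝ (x - y) (x + y - e) = 0 := by
      rw [inner_sub_right, real_inner_comm e (x - y), o1, inner_sub_left, inner_add_right,
        inner_add_right, real_inner_self_eq_norm_sq, real_inner_self_eq_norm_sq,
        real_inner_comm x y, hns, hnt]; ring
    have k1 : inner ℝ e (α • e + β • (x - y) + γ • (x + y - e)) = 0 := by
      rw [h, inner_zero_right]
    have k2 : inner ℝ (x - y) (α • e + β • (x - y) + γ • (x + y - e)) = 0 := by
      rw [h, inner_zero_right]
    rw [inner_add_right, inner_add_right, inner_smul_right, inner_smul_right, inner_smul_right,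
      o1, o2, real_inner_self_eq_norm_sq] at k1
    rw [inner_add_right, inner_add_right, inner_smul_right, inner_smul_right, inner_smul_right,
      o3, real_inner_comm, o1, real_inner_self_eq_norm_sq] at k2
    have hα : α = 0 := by
      have : α * ‖e‖ ^ 2 = 0 := by linarith
      exact (mul_eq_zero.1 this).resolve_right (by linarith)
    have hβ : β = 0 := by
      have : β * ‖x - y‖ ^ 2 = 0 := by linarith
      exact (mul_eq_zero.1 this).resolve_right (by
        have := norm_pos_iff.2 hsub
        positivity)
    subst hα hβ
    have hγ : γ ≠ 0 := fun h' => hn ⟨rfl, rfl, h'⟩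
    simp only [zero_smul, zero_add, smul_eq_zero, hγ, false_or] at h
    exact (sub_eq_zero.1 h).symm
  have hsthalf := hin s hsA t htA hst
  have hδ2 : ‖Q w - Q u‖ ^ 2 = 2 + 2 * inner ℝ (Q s - Q u) (Q t - Q u) := by
    rw [hrh, norm_add_sq_real, hns, hnt]; ring
  rw [heq] at hδ hsq
  have hst2 : inner ℝ (Q s - Q u) (Q t - Q u) = (1/2:ℝ) := by linarith
  have hlow : ∀ i ∈ A, ∀ j ∈ A, (-1/2:ℝ) ≤ inner ℝ (Q i - Q u) (Q j - Q u) := by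
    intro i hi j hj
    linarith [dist_ip i hi j hj, hsq i j]
  obtain ⟨r, hrA, hr⟩ : ∃ r ∈ A, r ∉ ({s, t} : Finset ι) := by
    apply Finset.exists_mem_notMem_of_card_lt_card
    rw [Finset.card_pair hst]; omega
  simp only [mem_insert, mem_singleton, not_or] at hr
  rcases three r hrA s hsA t htA hr.1 hst hr.2 with h | h | h
  · have e1 := le_antisymm h.1 (hlow r hrA t htA)
    exact planar_final _ _ _ _ (nA r hrA) hnt (hrh.trans (add_comm _ _)) (h.2 e1) e1 (iA r hrA)
  · have e1 := le_antisymm h.1 (hlow r hrA s hsA)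
    exact planar_final _ _ _ _ (nA r hrA) hns hrh (h.2 e1) e1 (iA r hrA)
  · linarith [h.1]

end

lemma spectral_two {ι : Type*} [Fintype ι] [DecidableEq ι] (W : Matrix ι ι ℝ)
    (hW : W.IsHermitian) (hrank : W.rank ≤ 2) (htr : W.trace = 0) (hne : W ≠ 0) :
    ∃ p q : ι → ℝ, (∀ i j, W i j = p i * q j + p j * q i) ∧
      ∀ f : ι → ℝ, W.mulVec f = 0 → p ⬝ᵥ f = 0 ∧ q ⬝ᵥ f = 0 := by
  set lam := hW.eigenvalues with hlam
  set U : ι → ι → ℝ := fun k => (hW.eigenvectorBasis k).ofLp with hU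
  have hsp : ∀ i j, W i j = ∑ k, lam k * (U k i * U k j) := by
    intro i j
    have h := congrFun (congrFun hW.spectral_theorem i) j
    rw [Unitary.conjStarAlgAut_apply, Matrix.mul_apply] at h
    rw [h]
    refine Finset.sum_congr rfl fun k _ => ?_
    rw [Matrix.mul_diagonal]
    simp [Matrix.star_apply, hU, hlam, Matrix.IsHermitian.eigenvectorUnitary_apply]
    ring
  have hker : ∀ k, lam k ≠ 0 → ∀ f : ι → ℝ, W.mulVec f = 0 → U k ⬝ᵥ f = 0 := by
    intro k hk f hf
    have h1 : W.mulVec (U k) = lam k • U k := hW.mulVec_eigenvectorBasis k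
    have h2 : (W.mulVec (U k)) ⬝ᵥ f = U k ⬝ᵥ W.mulVec f := by
      rw [Matrix.dotProduct_mulVec, ← Matrix.mulVec_transpose]
      congr 2
      have := hW.eq
      rw [Matrix.conjTranspose_eq_transpose_of_trivial] at this
      exact this.symm
    rw [h1, hf, dotProduct_zero, smul_dotProduct, smul_eq_mul] at h2
    exact (mul_eq_zero.1 h2).resolve_left hk
  have hsum : ∑ k, lam k = 0 := by
    have := hW.trace_eq_sum_eigenvalues
    rw [htr] at this
    simpa using this.symm
  have hcard : (univ.filter fun k => lam k ≠ 0).card ≤ 2 := by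
    have := hW.rank_eq_card_non_zero_eigs
    rw [Fintype.card_subtype] at this
    exact this ▸ hrank
  have h1 : ∃ k, lam k ≠ 0 := by
    by_contra! h
    apply hne
    ext i j
    rw [hsp]
    simp [h]
  obtain ⟨k, hk⟩ := h1
  have h2 : ∃ m, m ≠ k ∧ lam m ≠ 0 := by
    by_contra! h
    rw [Finset.sum_eq_single k (fun j _ hj => h j hj) (by simp)] at hsum
    exact hk hsum
  obtain ⟨m, hmk, hm⟩ := h2
  have hset : ({k, m} : Finset ι) = univ.filter fun k => lam k ≠ 0 := by
    apply Finset.eq_of_subset_of_card_le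
    · intro x hx
      simp only [mem_insert, mem_singleton] at hx
      rcases hx with rfl | rfl <;> simp [hk, hm]
    · rw [Finset.card_pair hmk.symm]; exact hcard
  have hz : ∀ x, x ∉ ({k, m} : Finset ι) → lam x = 0 := by
    intro x hx
    rw [hset] at hx
    simpa using hx
  have hsum2 : lam k + lam m = 0 := by
    rw [← Finset.sum_pair hmk.symm, ← hsum]
    exact Finset.sum_subset (Finset.subset_univ _) fun x _ hx => hz x hx
  have hW2 : ∀ i j, W i j = lam k * (U k i * U k j) + lam m * (U m i * U m j) := by
    intro i j
    rw [hsp, ← Finset.sum_pair (f := fun k => lam k * (U k i * U k j)) hmk.symm]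
    symm
    exact Finset.sum_subset (Finset.subset_univ _) fun x _ hx => by simp [hz x hx]
  refine ⟨fun i => lam k / 2 * (U k i + U m i), fun i => U k i - U m i, ?_, ?_⟩
  · intro i j
    rw [hW2, show lam m = - lam k by linarith]
    ring
  · intro f hf
    have a1 := hker k hk f hf
    have a2 := hker m hm f hf
    have e1 : (fun i => lam k / 2 * (U k i + U m i)) = (lam k / 2) • (U k + U m) := rfl
    have e2 : (fun i => U k i - U m i) = U k - U m := rfl
    rw [e1, e2, smul_dotProduct, add_dotProduct, sub_dotProduct, a1, a2]
    simp

section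
variable {V : Type*} [NormedAddCommGroup V] [InnerProductSpace ℝ V]
  {ι : Type*} [Fintype ι] [DecidableEq ι]

lemma mulVec_ip (W : Matrix ι ι ℝ) (Q : ι → V) (hQ : ∀ i, ∑ j, W i j • Q j = 0) (y : V) :
    W.mulVec (fun i => inner ℝ y (Q i)) = 0 := by
  ext i
  have : inner ℝ y (∑ j, W i j • Q j) = 0 := by rw [hQ, inner_zero_right]
  rw [inner_sum] at this
  simpa [Matrix.mulVec, dotProduct, inner_smul_right] using this

lemma mulVec_const (W : Matrix ι ι ℝ) (hrow : ∀ i, ∑ j, W i j = 0) (c : ℝ) :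
    W.mulVec (fun _ => c) = 0 := by
  ext i
  simp [Matrix.mulVec, dotProduct, ← Finset.sum_mul, hrow]

lemma rank_bound (W : Matrix ι ι ℝ) (Q : ι → V) (hrow : ∀ i, ∑ j, W i j = 0)
    (hQ : ∀ i, ∑ j, W i j • Q j = 0) (i₀ : ι) :
    W.rank + (1 + Module.finrank ℝ (Submodule.span ℝ (Set.range fun i => Q i - Q i₀))) ≤
      Fintype.card ι := by
  set S := Submodule.span ℝ (Set.range fun i => Q i - Q i₀) with hS
  have : FiniteDimensional ℝ S := FiniteDimensional.span_of_finite ℝ (Set.finite_range _)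
  let F : (ℝ × S) →ₗ[ℝ] (ι → ℝ) :=
    { toFun := fun z i => z.1 + inner ℝ (z.2 : V) (Q i - Q i₀)
      map_add' := by
        intro a b; ext i; simp [inner_add_left]; ring
      map_smul' := by
        intro a b; ext i; simp [real_inner_smul_left]; ring }
  have hF : ∀ z i, F z i = z.1 + inner ℝ (z.2 : V) (Q i - Q i₀) := fun _ _ => rfl
  have hinj : Function.Injective F := by
    rw [← LinearMap.ker_eq_bot, LinearMap.ker_eq_bot']
    rintro ⟨c, y⟩ h
    have h0 : ∀ i, c + inner ℝ (y : V) (Q i - Q i₀) = 0 := fun i => congrFun h i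
    have hc : c = 0 := by simpa using h0 i₀
    have hy : ∀ x ∈ S, inner ℝ (y : V) x = 0 := by
      intro x hx
      induction hx using Submodule.span_induction with
      | mem x hx =>
        obtain ⟨i, rfl⟩ := hx
        have := h0 i
        rw [hc, zero_add] at this
        exact this
      | zero => simp
      | add x y _ _ h1 h2 => rw [inner_add_right, h1, h2, add_zero]
      | smul a x _ h1 => rw [inner_smul_right, h1, mul_zero]
    have hy0 : (y : V) = 0 := inner_self_eq_zero.1 (hy y y.2)
    ext
    · exact hc
    · exact hy0
  have hle : LinearMap.range F ≤ LinearMap.ker W.mulVecLin := by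
    rintro _ ⟨⟨c, y⟩, rfl⟩
    rw [LinearMap.mem_ker, Matrix.mulVecLin_apply]
    have : F (c, y) = (fun _ => c - inner ℝ (y : V) (Q i₀)) + fun i => inner ℝ (y : V) (Q i) := by
      ext i
      rw [hF, inner_sub_right]
      simp only [Pi.add_apply]
      ring
    rw [this, Matrix.mulVec_add, mulVec_const W hrow, mulVec_ip W Q hQ, add_zero]
  have h1 := Submodule.finrank_mono hle
  rw [LinearMap.finrank_range_of_inj hinj, Module.finrank_prod, Module.finrank_self] at h1
  have h2 := LinearMap.finrank_range_add_finrank_ker W.mulVecLin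
  rw [Module.finrank_fintype_fun_eq_card] at h2
  have h3 : W.rank = Module.finrank ℝ (LinearMap.range W.mulVecLin) := rfl
  omega

lemma sum_D (p : ι → ℝ) (Q : ι → V) (hs : ∑ j, p j = 0)
    (hip : ∀ y : V, ∑ j, p j * inner ℝ y (Q j) = 0) (k : ι) :
    ∑ j, ((if k = j then 0 else ‖Q k - Q j‖ ^ 2 - 1) : ℝ) * p j = p k + ∑ j, p j * ‖Q j‖ ^ 2 := by
  have h1 : ∀ j, ((if k = j then 0 else ‖Q k - Q j‖ ^ 2 - 1) : ℝ) * p j =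
      (if k = j then p j else 0) + ‖Q k‖ ^ 2 * p j - 2 * (p j * inner ℝ (Q k) (Q j))
        + p j * ‖Q j‖ ^ 2 - p j := by
    intro j
    by_cases h : k = j
    · subst h
      rw [if_pos rfl, if_pos rfl, real_inner_self_eq_norm_sq]; ring
    · rw [if_neg h, if_neg h, norm_sub_sq_real]; ring
  simp only [h1, Finset.sum_add_distrib, Finset.sum_sub_distrib, ← Finset.mul_sum, hs, hip]
  simp

lemma core_false [Nonempty ι] (W : Matrix ι ι ℝ) (Q : ι → V)
    (hcard : Fintype.card ι ≤ 6) (hsym : ∀ i j, W i j = W j i)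
    (hrow : ∀ i, ∑ j, W i j = 0) (hQ : ∀ i, ∑ j, W i j • Q j = 0)
    (hedge : ∀ i j, i ≠ j → W i j ≠ 0 → ‖Q j - Q i‖ = 1)
    (hsep : ∀ i j, i ≠ j → 1 ≤ ‖Q i - Q j‖) (hnz : ∀ i, ∃ j, W i j ≠ 0) : False := by
  let i₀ : ι := Classical.arbitrary ι
  set S := Submodule.span ℝ (Set.range fun i => Q i - Q i₀) with hS
  have : FiniteDimensional ℝ S := FiniteDimensional.span_of_finite ℝ (Set.finite_range _)
  have hrk := rank_bound W Q hrow hQ i₀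
  rw [← hS] at hrk
  by_cases hfin : Module.finrank ℝ S ≤ 2
  · have hmem : ∀ i, Q i - Q i₀ ∈ S := fun i => Submodule.subset_span ⟨i, rfl⟩
    refine planar_false W Q hcard hrow hQ hedge hsep hnz S ?_ ?_
    · intro i j
      have := S.sub_mem (hmem i) (hmem j)
      rwa [sub_sub_sub_cancel_right] at this
    · intro x hx y hy z hz
      have hd : ¬ LinearIndependent ℝ ![(⟨x, hx⟩ : S), ⟨y, hy⟩, ⟨z, hz⟩] := by
        intro h
        have := h.fintype_card_le_finrank
        simp at this
        omega
      rw [Fintype.not_linearIndependent_iff] at hd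
      obtain ⟨g, hg, i, hi⟩ := hd
      refine ⟨g 0, g 1, g 2, ?_, ?_⟩
      · rintro ⟨h0, h1, h2⟩
        fin_cases i <;> simp_all
      · have := congrArg Subtype.val hg
        simpa [Fin.sum_univ_three] using this
  · have hr2 : W.rank ≤ 2 := by omega
    have hherm : W.IsHermitian := by
      ext i j
      simp [Matrix.conjTranspose_apply, hsym i j]
    set E : ι → ι → ℝ := fun k j => if k = j then 0 else ‖Q k - Q j‖ ^ 2 - 1 with hE
    have hEW : ∀ i j, E i j ≠ 0 → W i j = 0 := by
      intro i j h
      by_contra hW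
      apply h
      by_cases hij : i = j
      · simp [hE, hij]
      · have := hedge i j hij hW
        rw [norm_sub_rev] at this
        simp [hE, this]
    have hipW : ∀ i, ∀ y : V, ∑ j, W i j * inner ℝ y (Q j) = 0 := by
      intro i y
      exact congrFun (mulVec_ip W Q hQ y) i
    have htr : W.trace = 0 := by
      -- evaluate the distance identity on row k, at column k
      have h1 : ∀ i k, ∑ j, E k j * W i j = W i k + ∑ j, W i j * ‖Q j‖ ^ 2 := fun i k =>
        sum_D (fun j => W i j) Q (hrow i) (hipW i) k
      have h2 : ∀ i, ∑ j, W i j * ‖Q j‖ ^ 2 = - W i i := by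
        intro i
        have := h1 i i
        rw [Finset.sum_eq_zero] at this
        · linarith
        · intro j _
          by_cases h : E i j = 0
          · simp [h]
          · simp [hEW i j h]
      have hcol : ∀ j, ∑ i, W i j = 0 := by
        intro j
        rw [← hrow j]
        exact Finset.sum_congr rfl fun i _ => hsym i j
      have h3 : ∑ i, ∑ j, W i j * ‖Q j‖ ^ 2 = 0 := by
        rw [Finset.sum_comm]
        simp [← Finset.sum_mul, hcol]
      simp only [h2, Finset.sum_neg_distrib, neg_eq_zero] at h3
      simpa [Matrix.trace] using h3
    have hne : W ≠ 0 := by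
      rintro rfl
      obtain ⟨j, hj⟩ := hnz i₀
      simp at hj
    obtain ⟨p, q, hpq, hker⟩ := spectral_two W hherm hr2 htr hne
    have hc := hker _ (mulVec_const W hrow 1)
    have hi := fun y => hker _ (mulVec_ip W Q hQ y)
    have hsp : ∑ j, p j = 0 := by simpa [dotProduct] using hc.1
    have hsq : ∑ j, q j = 0 := by simpa [dotProduct] using hc.2
    have hp := sum_D p Q hsp (fun y => (hi y).1)
    have hq := sum_D q Q hsq (fun y => (hi y).2)
    have := rank_two_core E p q _ _ ?_ ?_ ?_ hp hq hsp hsq ?_ ?_ ?_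
    · omega
    · intro i j
      by_cases h : i = j
      · simp [hE, h]
      · have := hsep i j h
        simp only [hE, if_neg h]
        nlinarith
    · intro i; simp [hE]
    · intro i j h
      rw [← hpq]; exact hEW i j h
    · intro i
      by_contra! h
      obtain ⟨j, hj⟩ := hnz i
      apply hj
      rw [hpq, h.1, h.2]; ring
    · by_contra! h
      apply hne
      ext i j
      rw [hpq]; simp [h]
    · by_contra! h
      apply hne
      ext i j
      rw [hpq]; simp [h]

end

theorem no_critical_config_with_few_points
    (ℓ N : ℕ) (hℓ : 2 ≤ ℓ) (hN : 1 ≤ N)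
    (a : Fin ℓ → Fin ℓ → ℝ) (hsym : ∀ i j, a i j = a j i)
    (Q : Fin ℓ → EuclideanSpace ℝ (Fin N))
    (hsep : ∀ i j, i ≠ j → 1 ≤ ‖Q i - Q j‖)
    (hzero : ∀ i j, i ≠ j → 1 < ‖Q i - Q j‖ → a i j = 0)
    (i₀ j₀ : Fin ℓ) (hij : i₀ ≠ j₀) (ha : a i₀ j₀ ≠ 0)
    (hcrit : ∀ i, ∑ j ∈ Finset.univ.erase i,
      (a i j / ‖Q i - Q j‖) • (Q i - Q j) = (0 : EuclideanSpace ℝ (Fin N))) :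
    7 ≤ ℓ := by
  by_contra! hlt
  -- off-diagonal part and stress matrix
  set b : Fin ℓ → Fin ℓ → ℝ := fun i j => if i = j then 0 else a i j with hb
  set W : Fin ℓ → Fin ℓ → ℝ := fun i j => b i j - if i = j then ∑ k, b i k else 0 with hW
  have hbsym : ∀ i j, b i j = b j i := by
    intro i j
    simp only [hb, eq_comm (a := i) (b := j), hsym i j]
  have hoff : ∀ i j, i ≠ j → W i j = a i j := by
    intro i j h
    simp [hW, hb, h]
  have hWsym : ∀ i j, W i j = W j i := by
    intro i j
    by_cases h : i = j
    · rw [h]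
    · rw [hoff i j h, hoff j i (Ne.symm h), hsym]
  have hrow : ∀ i, ∑ j, W i j = 0 := by
    intro i
    simp [hW, Finset.sum_sub_distrib]
  have hunit : ∀ i j, i ≠ j → a i j ≠ 0 → ‖Q i - Q j‖ = 1 := by
    intro i j h h'
    refine le_antisymm ?_ (hsep i j h)
    by_contra! h2
    exact h' (hzero i j h h2)
  have hbal : ∀ i, ∑ j, W i j • Q j = 0 := by
    intro i
    have h1 : ∑ j, b i j • (Q i - Q j) = 0 := by
      rw [← hcrit i, ← Finset.add_sum_erase _ _ (mem_univ i)]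
      simp only [sub_self, smul_zero, zero_add]
      refine Finset.sum_congr rfl fun j hj => ?_
      have hne : i ≠ j := (Finset.ne_of_mem_erase hj).symm
      by_cases h : a i j = 0
      · simp [hb, h]
      · rw [hunit i j hne h, div_one]
        simp [hb, hne]
    simp only [smul_sub, Finset.sum_sub_distrib, ← Finset.sum_smul] at h1
    simp only [hW, sub_smul, Finset.sum_sub_distrib, ite_smul, zero_smul,
      Finset.sum_ite_eq, mem_univ, if_true]
    rw [← neg_eq_zero, neg_sub, h1]
  -- restrict to nonzero rows
  let ι := {i : Fin ℓ // ∃ j, W i j ≠ 0}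
  have : Nonempty ι := ⟨⟨i₀, j₀, by rw [hoff _ _ hij]; exact ha⟩⟩
  have hcard : Fintype.card ι ≤ 6 := by
    refine (Fintype.card_subtype_le (fun i : Fin ℓ => ∃ j, W i j ≠ 0)).trans ?_
    rw [Fintype.card_fin]
    omega
  have hout : ∀ i j, (¬ ∃ k, W j k ≠ 0) → W i j = 0 := by
    intro i j h
    push Not at h
    rw [hWsym]; exact h i
  have hrestr : ∀ {M : Type} [AddCommMonoid M] (f : Fin ℓ → M),
      (∀ j, (¬ ∃ k, W j k ≠ 0) → f j = 0) → ∑ j : ι, f j = ∑ j, f j := by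
    intro M _ f hf
    rw [← Finset.sum_subtype (univ.filter fun i : Fin ℓ => ∃ j, W i j ≠ 0) (by intro x; simp) f]
    refine Finset.sum_subset (Finset.subset_univ _) fun j _ hj => hf j ?_
    intro h
    exact hj (by simpa using h)
  refine core_false (ι := ι) (fun i j => W i j) (fun i => Q i) hcard ?_ ?_ ?_ ?_ ?_ ?_
  · intro i j; exact hWsym i j
  · intro i
    rw [hrestr (fun j => W i j) (fun j h => hout i j h)]
    exact hrow i
  · intro i
    rw [hrestr (fun j => W i j • Q j) (fun j h => by simp only [hout i j h, zero_smul])]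
    exact hbal i
  · intro i j h h'
    have hne : (i : Fin ℓ) ≠ j := fun h'' => h (Subtype.ext h'')
    rw [norm_sub_rev]
    exact hunit i j hne (by rw [← hoff _ _ hne]; exact h')
  · intro i j h
    exact hsep i j (fun h'' => h (Subtype.ext h''))
  · rintro ⟨i, j, hj⟩
    exact ⟨⟨j, i, by rw [hWsym]; exact hj⟩, hj⟩
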